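/- arXiv:2302.13060 — 13 statements merged into one kernel-verified Lean document; each statement's English description precedes it below -/
import Mathlib

section
/- For every infinite cardinal κ, the Cantor cube 2^κ (the product of κ copies of the two-point discrete space, with the product topology) contains a dense subset F with |F| = κ such that F, with the subspace topology, has countable pseudocharacter: every point of F is the intersection of countably many relatively open subsets of F. -/
open Set Cardinal

universe u

/-- The point of `ι → Bool` that agrees on the finite set `p.1` with the indicator of `p.2`, and
elsewhere with the indicator of the fibre over `p` of the first component of `e`. -/
noncomputable def finitePatchPoint {ι : Type u} (e : ι → (Finset ι × Finset ι) × ℕ)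
    (p : Finset ι × Finset ι) : ι → Bool := by
  classical
  exact fun i => if i ∈ p.1 then decide (i ∈ p.2) else decide ((e i).1 = p)

theorem exists_finitePatchPoint_ne {ι : Type u} (e : ι ≃ (Finset ι × Finset ι) × ℕ)
    {p q : Finset ι × Finset ι} (hpq : p ≠ q) :
    ∃ n : ℕ, finitePatchPoint e q (e.symm (p, n)) ≠ finitePatchPoint e p (e.symm (p, n)) := by
  classical
  have hinj : Function.Injective fun n : ℕ => e.symm (p, n) := fun m n h => by simpa using h
  obtain ⟨n, hn⟩ := ((p.1 ∪ q.1).finite_toSet.preimage hinj.injOn).exists_notMem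
  have hn' : e.symm (p, n) ∉ p.1 ∧ e.symm (p, n) ∉ q.1 := by simpa using hn
  exact ⟨n, by simp [finitePatchPoint, hn'.1, hn'.2, hpq]⟩

theorem dense_range_finitePatchPoint {ι : Type u} (e : ι → (Finset ι × Finset ι) × ℕ) :
    Dense (range (finitePatchPoint e)) := by
  classical
  refine dense_iff_inter_open.2 fun U hU ⟨g, hg⟩ => ?_
  obtain ⟨s, u, hu, hsub⟩ := isOpen_pi_iff.1 hU g hg
  refine ⟨finitePatchPoint e (s, s.filter fun i => g i = true), hsub fun i hi => ?_,
    mem_range_self _⟩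
  have hi' : i ∈ s := hi
  have hval : finitePatchPoint e (s, s.filter fun i => g i = true) i = g i := by
    simp [finitePatchPoint, hi']
  rw [hval]
  exact (hu i hi').2

/-- For every infinite cardinal `κ`, the Cantor cube `2^κ`
(here `ι → Bool` for any index type `ι` of cardinality `κ`, with the product
topology, `Bool` being discrete) contains a dense subset `F` of cardinality `κ`
which has countable pseudocharacter in the subspace topology. -/
theorem cantor_cube_dense_countable_pseudocharacter
    (κ : Cardinal.{u}) (hκ : ℵ₀ ≤ κ) (ι : Type u) (hι : #ι = κ) :
    ∃ F : Set (ι → Bool), Dense F ∧ #F = κ ∧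
      ∀ x : F, ∃ 𝒰 : Set (Set F), 𝒰.Countable ∧
        (∀ U ∈ 𝒰, IsOpen U ∧ x ∈ U) ∧ ⋂₀ 𝒰 = {x} := by
  have hinf : Infinite ι := infinite_iff.2 (hι ▸ hκ)
  have hP : #(Finset ι × Finset ι) = κ := by
    simp [mk_finset_of_infinite, hι, mul_eq_self hκ]
  obtain ⟨e⟩ : Nonempty (ι ≃ (Finset ι × Finset ι) × ℕ) := by
    rw [← lift_mk_eq', mk_prod, hP]
    simp [hι, mul_aleph0_eq hκ]
  have hinj : Function.Injective (finitePatchPoint e) := fun p q h => by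
    by_contra hpq
    obtain ⟨n, hn⟩ := exists_finitePatchPoint_ne e hpq
    exact hn (by rw [h])
  refine ⟨range (finitePatchPoint e), dense_range_finitePatchPoint e,
    (mk_range_eq _ hinj).trans hP, ?_⟩
  rintro ⟨_, p, rfl⟩
  refine ⟨range fun n : ℕ => {y | y.1 (e.symm (p, n)) = finitePatchPoint e p (e.symm (p, n))},
    countable_range _, ?_, ?_⟩
  · rintro _ ⟨n, rfl⟩
    refine ⟨?_, rfl⟩
    have hcont : Continuous fun y : range (finitePatchPoint e) => y.1 (e.symm (p, n)) :=
      (continuous_apply _).comp continuous_subtype_val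
    exact (isOpen_discrete {finitePatchPoint e p (e.symm (p, n))}).preimage hcont
  · refine Subset.antisymm ?_ ?_
    · rintro ⟨_, q, rfl⟩ hy
      by_contra hne
      have hpq : p ≠ q := by
        rintro rfl
        exact hne rfl
      obtain ⟨n, hn⟩ := exists_finitePatchPoint_ne e hpq
      exact hn (hy _ ⟨n, rfl⟩)
    · rintro _ rfl _ ⟨n, rfl⟩
      rfl
end

section
/- Let n ≥ 2 be an integer, X an n-Hausdorff topological space, and κ, λ infinite cardinals. If X has a network 𝒩 with |𝒩| ≤ λ and n-ψ(X) ≤ κ, then |X| ≤ λ^κ. -/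
open Set Cardinal

universe u

/-- `X` is `n`-Hausdorff: any `n` pairwise distinct points admit open
neighbourhoods with empty intersection. -/
def NHausdorff (X : Type u) [TopologicalSpace X] (n : ℕ) : Prop :=
  ∀ x : Fin n → X, Function.Injective x →
    ∃ U : Fin n → Set X, (∀ i, IsOpen (U i) ∧ x i ∈ U i) ∧ (⋂ i, U i) = ∅

/-- `𝒩` is a network for `X`. -/
def IsNetwork (X : Type u) [TopologicalSpace X] (𝒩 : Set (Set X)) : Prop :=
  ∀ (x : X) (U : Set X), IsOpen U → x ∈ U → ∃ N ∈ 𝒩, x ∈ N ∧ N ⊆ U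

/-- `n-ψ(X) ≤ κ`: each point `x` has a family of at most `κ` open
neighbourhoods such that for any `n` pairwise distinct points the intersection
of all members of the corresponding families is empty. -/
def NPsiLe (X : Type u) [TopologicalSpace X] (n : ℕ) (κ : Cardinal.{u}) : Prop :=
  ∃ V : X → Set (Set X),
    (∀ x : X, #(V x) ≤ κ ∧ ∀ U ∈ V x, IsOpen U ∧ x ∈ U) ∧
    ∀ x : Fin n → X, Function.Injective x → (⋂ i, ⋂ U ∈ V (x i), U) = ∅

/-- A map whose fibers are all finite, into a type of subsets of size at most `κ` of a set of
cardinality at most `lam`, has domain of cardinality at most `lam ^ κ`. -/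
theorem mk_le_pow_of_finite_fibers {X Y : Type u} {κ lam : Cardinal.{u}} (hκ : ℵ₀ ≤ κ)
    (hlam : ℵ₀ ≤ lam) (hY : #Y ≤ lam) (F : X → {t : Set Y // #t ≤ κ})
    (hF : ∀ t, (F ⁻¹' {t}).Finite) : #X ≤ lam ^ κ := by
  have hpow : ℵ₀ ≤ lam ^ κ := hlam.trans (self_le_power lam (one_le_aleph0.trans hκ))
  calc
    #X ≤ #{t : Set Y // #t ≤ κ} * ℵ₀ :=
      mk_le_mk_mul_of_mk_preimage_le F fun t => (hF t).lt_aleph0.le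
    _ ≤ lam ^ κ * lam ^ κ :=
      mul_le_mul' ((mk_bounded_set_le Y κ).trans (power_le_power_right (max_le hY hlam))) hpow
    _ = lam ^ κ := mul_eq_self hpow

/-- if the `n`-Hausdorff space `X` has a network of cardinality
`≤ λ` and `n-ψ(X) ≤ κ`, then `|X| ≤ λ^κ`. -/
theorem card_le_network_pow_nPsi (n : ℕ) (hn : 2 ≤ n)
    (X : Type u) [TopologicalSpace X] (hX : NHausdorff X n)
    (κ lam : Cardinal.{u}) (hκ : ℵ₀ ≤ κ) (hlam : ℵ₀ ≤ lam)
    (𝒩 : Set (Set X)) (hnet : IsNetwork X 𝒩) (hcard : #𝒩 ≤ lam)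
    (hpsi : NPsiLe X n κ) :
    #X ≤ lam ^ κ := by
  obtain ⟨V, hV, hVn⟩ := hpsi
  choose N hN hxN hNU using fun (x : X) (U : V x) =>
    hnet x U ((hV x).2 U U.2).1 ((hV x).2 U U.2).2
  let F : X → {t : Set 𝒩 // #t ≤ κ} := fun x =>
    ⟨range fun U : V x => (⟨N x U, hN x U⟩ : 𝒩), mk_range_le.trans (hV x).1⟩
  refine mk_le_pow_of_finite_fibers hκ hlam hcard F fun t => ?_
  by_contra hinf
  have := Set.Infinite.to_subtype hinf
  let e := Infinite.natEmbedding (F ⁻¹' {t})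
  let x : Fin n → X := fun i => e i
  have hx : Function.Injective x := fun i j hij =>
    Fin.ext (e.injective (Subtype.ext hij))
  have hmem : x ⟨0, by omega⟩ ∈ ⋂ i, ⋂ U ∈ V (x i), U := by
    simp only [mem_iInter]
    intro i U hU
    have hFi : F (x i) = F (x ⟨0, by omega⟩) :=
      (e i).2.trans (e 0).2.symm
    have hmemF : (⟨N (x i) ⟨U, hU⟩, hN _ _⟩ : 𝒩) ∈ (F (x ⟨0, by omega⟩)).1 :=
      hFi ▸ mem_range_self (⟨U, hU⟩ : V (x i))
    obtain ⟨W, hW⟩ := hmemF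
    have hWN : N (x ⟨0, by omega⟩) W = N (x i) ⟨U, hU⟩ := congrArg Subtype.val hW
    exact hNU (x i) ⟨U, hU⟩ (hWN ▸ hxN _ W)
  rw [hVn x hx] at hmem
  exact hmem
end

section
/- Let n ≥ 2 be an integer, X a T₁ n-Hausdorff topological space, and κ, λ infinite cardinals. If X has a ψ-base ℬ with |ℬ| ≤ λ, l(X) ≤ κ, and n-ψ(X) ≤ κ, then |X| ≤ λ^κ. -/
open Set Cardinal

universe u

/-- `ℬ` is a ψ-base (pseudobase) for `X`. -/
def IsPsiBase (X : Type u) [TopologicalSpace X] (ℬ : Set (Set X)) : Prop :=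
  (∀ B ∈ ℬ, IsOpen B) ∧ ∀ x : X, (⋂₀ {B ∈ ℬ | x ∈ B}) = {x}

/-- The Lindelöf degree of `X` is at most `κ`: every open cover has a subcover
of cardinality `≤ κ`. -/
def LindelofDegLe (X : Type u) [TopologicalSpace X] (κ : Cardinal.{u}) : Prop :=
  ∀ 𝒰 : Set (Set X), (∀ U ∈ 𝒰, IsOpen U) → ⋃₀ 𝒰 = Set.univ →
    ∃ 𝒱 ⊆ 𝒰, #𝒱 ≤ κ ∧ ⋃₀ 𝒱 = Set.univ

theorem LindelofDegLe.exists_subset_cover_of_isClosed {X : Type u} [TopologicalSpace X]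
    {κ : Cardinal.{u}} (hl : LindelofDegLe X κ) {F : Set X} (hF : IsClosed F)
    {𝒞 : Set (Set X)} (hopen : ∀ U ∈ 𝒞, IsOpen U) (hcov : F ⊆ ⋃₀ 𝒞) :
    ∃ 𝒱 ⊆ 𝒞, #𝒱 ≤ κ ∧ F ⊆ ⋃₀ 𝒱 := by
  obtain ⟨𝒱, hsub, hcard, huniv⟩ := hl (insert Fᶜ 𝒞)
    (by
      rintro U (rfl | hU)
      · exact hF.isOpen_compl
      · exact hopen U hU)
    (by
      rw [sUnion_insert, eq_univ_iff_forall]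
      intro y
      by_cases hy : y ∈ F
      · exact Or.inr (hcov hy)
      · exact Or.inl hy)
  refine ⟨𝒱 ∩ 𝒞, inter_subset_right, (mk_le_mk_of_subset inter_subset_left).trans hcard, ?_⟩
  intro y hy
  obtain ⟨U, hU, hyU⟩ : y ∈ ⋃₀ 𝒱 := huniv ▸ mem_univ y
  rcases hsub hU with rfl | hUC
  · exact absurd hy hyU
  · exact ⟨U, ⟨hU, hUC⟩, hyU⟩

/-- If `x` has at most `κ` chosen open neighbourhoods, then at most `κ` members of the ψ-base,
none of them containing `x`, cover the complement of their intersection. -/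
theorem IsPsiBase.exists_subset_cover_compl_sInter {X : Type u} [TopologicalSpace X]
    {κ : Cardinal.{u}} (hκ : ℵ₀ ≤ κ) {ℬ : Set (Set X)} (hB : IsPsiBase X ℬ)
    (hl : LindelofDegLe X κ) {x : X} {𝒰 : Set (Set X)} (hcard : #𝒰 ≤ κ)
    (h𝒰 : ∀ U ∈ 𝒰, IsOpen U ∧ x ∈ U) :
    ∃ 𝒲 ⊆ ℬ, #𝒲 ≤ κ ∧ x ∉ ⋃₀ 𝒲 ∧ (⋃₀ 𝒲)ᶜ ⊆ ⋂₀ 𝒰 := by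
  have key : ∀ U : 𝒰, ∃ 𝒱 ⊆ {B ∈ ℬ | x ∉ B}, #𝒱 ≤ κ ∧ (U : Set X)ᶜ ⊆ ⋃₀ 𝒱 := by
    intro U
    refine hl.exists_subset_cover_of_isClosed (h𝒰 U U.2).1.isClosed_compl
      (fun B hBm => hB.1 B hBm.1) fun y hy => ?_
    by_contra hcon
    have hmem : x ∈ ⋂₀ {B ∈ ℬ | y ∈ B} := by
      rintro B ⟨hBm, hyB⟩
      by_contra hxB
      exact hcon ⟨B, ⟨hBm, hxB⟩, hyB⟩
    rw [hB.2 y, mem_singleton_iff] at hmem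
    exact hy (hmem ▸ (h𝒰 U U.2).2)
  choose 𝒱 hsub hVcard hcov using key
  refine ⟨⋃ U, 𝒱 U, iUnion_subset fun U B hBm => (hsub U hBm).1, ?_, ?_, ?_⟩
  · calc #(⋃ U, 𝒱 U) ≤ Cardinal.sum fun U => #(𝒱 U) := mk_iUnion_le_sum_mk
      _ ≤ Cardinal.sum fun _ : 𝒰 => κ := sum_le_sum _ _ hVcard
      _ = #𝒰 * κ := sum_const' _ _
      _ ≤ κ * κ := by gcongr
      _ = κ := mul_eq_self hκ
  · rintro ⟨B, hBm, hxB⟩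
    obtain ⟨U, hU⟩ := mem_iUnion.1 hBm
    exact (hsub U hU).2 hxB
  · intro y hy U hU
    by_contra hyU
    obtain ⟨B, hBm, hyB⟩ := hcov ⟨U, hU⟩ hyU
    exact hy ⟨B, mem_iUnion.2 ⟨_, hBm⟩, hyB⟩

/-- for a `T₁` `n`-Hausdorff space `X` with a ψ-base of
cardinality `≤ λ`, `l(X) ≤ κ` and `n-ψ(X) ≤ κ`, one has `|X| ≤ λ^κ`. -/
theorem card_le_psiBase_pow (n : ℕ) (hn : 2 ≤ n)
    (X : Type u) [TopologicalSpace X] [T1Space X] (hX : NHausdorff X n)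
    (κ lam : Cardinal.{u}) (hκ : ℵ₀ ≤ κ) (hlam : ℵ₀ ≤ lam)
    (ℬ : Set (Set X)) (hB : IsPsiBase X ℬ) (hBcard : #ℬ ≤ lam)
    (hl : LindelofDegLe X κ) (hpsi : NPsiLe X n κ) :
    #X ≤ lam ^ κ := by
  obtain ⟨V, hV, hempty⟩ := hpsi
  choose 𝒲 hsub hWcard hx hcompl using fun x =>
    hB.exists_subset_cover_compl_sInter hκ hl (hV x).1 (hV x).2
  let f : X → {t : Set (Set X) // t ⊆ ℬ ∧ #t ≤ κ} := fun x => ⟨𝒲 x, hsub x, hWcard x⟩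
  have hfiber : ∀ t, #(f ⁻¹' {t}) ≤ ℵ₀ := by
    intro t
    by_contra! hlt
    have : Infinite (f ⁻¹' {t}) := infinite_iff.2 hlt.le
    let e := Infinite.natEmbedding (f ⁻¹' {t})
    have heq : ∀ k, 𝒲 (e k) = t := fun k => congrArg Subtype.val (e k).2
    have hinj : Function.Injective fun i : Fin n => (e i : X) := fun i j hij =>
      Fin.ext (e.injective (Subtype.ext hij))
    refine (eq_empty_iff_forall_notMem.1 (hempty _ hinj)) (e 0) ?_
    simp only [mem_iInter]
    intro i U hU
    refine hcompl (e i) ?_ U hU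
    rw [heq i, ← heq 0]
    exact hx (e 0)
  have hle : ℵ₀ ≤ lam ^ κ :=
    hlam.trans (self_le_power lam (one_le_aleph0.trans hκ))
  calc #X ≤ #{t : Set (Set X) // t ⊆ ℬ ∧ #t ≤ κ} * ℵ₀ :=
        mk_le_mk_mul_of_mk_preimage_le f hfiber
    _ ≤ max #ℬ ℵ₀ ^ κ * ℵ₀ := by
        gcongr
        exact mk_bounded_subset_le ℬ κ
    _ ≤ lam ^ κ * lam ^ κ := by
        gcongr
        exact power_le_power_right (max_le hBcard hlam)
    _ = lam ^ κ := mul_eq_self hle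
end

section
/- Let X be a Hausdorff topological space and κ, λ infinite cardinals. If X has a dense subset D with |D| ≤ λ and t(X) ≤ κ, then X has a ψ-base ℬ with |ℬ| ≤ λ^κ. -/
open Set Cardinal

universe u

/-- The tightness of `X` is at most `κ`. -/
def TightnessLe (X : Type u) [TopologicalSpace X] (κ : Cardinal.{u}) : Prop :=
  ∀ (x : X) (A : Set X), x ∈ closure A → ∃ B ⊆ A, #B ≤ κ ∧ x ∈ closure B

/-- The family of complements of closures of small subsets of a dense set is a ψ-base, where small means
of cardinality at most the tightness. -/
theorem isPsiBase_compl_closure {X : Type u} [TopologicalSpace X] [T2Space X]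
    {κ : Cardinal.{u}} {D : Set X} (hD : Dense D) (ht : TightnessLe X κ) :
    IsPsiBase X (range fun A : {A : Set X // A ⊆ D ∧ #A ≤ κ} => (closure A.1)ᶜ) := by
  refine ⟨?_, fun x => Subset.antisymm (fun y hy => ?_) ?_⟩
  · rintro _ ⟨A, rfl⟩
    exact isClosed_closure.isOpen_compl
  · by_contra hne
    obtain ⟨U, V, hU, hV, hxU, hyV, hUV⟩ := t2_separation (Ne.symm hne : x ≠ y)
    obtain ⟨A, hA, hAcard, hyA⟩ := ht y (V ∩ D) (hD.open_subset_closure_inter hV hyV)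
    have hAU : A ⊆ Uᶜ := fun z hz hzU => disjoint_left.mp hUV hzU (hA hz).1
    have hxA : x ∉ closure A := fun hx => closure_minimal hAU hU.isClosed_compl hx hxU
    exact hy _ ⟨⟨⟨A, hA.trans inter_subset_right, hAcard⟩, rfl⟩, hxA⟩ hyA
  · rintro _ rfl B ⟨-, hB⟩
    exact hB

/-- a Hausdorff space with a dense subset of cardinality `≤ λ`
and tightness `≤ κ` has a ψ-base of cardinality `≤ λ^κ`. -/
theorem psiBase_le_density_pow_tightness (X : Type u) [TopologicalSpace X] [T2Space X]
    (κ lam : Cardinal.{u}) (hκ : ℵ₀ ≤ κ) (hlam : ℵ₀ ≤ lam)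
    (D : Set X) (hD : Dense D) (hDcard : #D ≤ lam)
    (ht : TightnessLe X κ) :
    ∃ ℬ : Set (Set X), IsPsiBase X ℬ ∧ #ℬ ≤ lam ^ κ := by
  refine ⟨_, isPsiBase_compl_closure hD ht, mk_range_le.trans ?_⟩
  refine (mk_bounded_subset_le D κ).trans ?_
  exact power_le_power_right (max_le hDcard hlam)
end

section
/- Let X be a Hausdorff topological space and κ an infinite cardinal. Then 2-ψ_c(X) ≤ κ if and only if ψ_c(X) ≤ κ. Concretely: there exists, for each x ∈ X, a family {V(α,x) : α < κ} of open neighborhoods of x such that for any two distinct points x, y ∈ X one has (⋂_{α<κ} cl(V(α,x))) ∩ (⋂_{α<κ} cl(V(α,y))) = ∅, if and only if each x ∈ X has a family of at most κ open neighborhoods whose closures intersect exactly in {x}. -/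
open Set Cardinal

universe u

/-- For a Hausdorff space `X` and an infinite cardinal `κ`,
`2-ψ_c(X) ≤ κ` iff `ψ_c(X) ≤ κ`. -/
theorem two_psiC_eq_psiC (X : Type u) [TopologicalSpace X] [T2Space X]
    (κ : Cardinal.{u}) (hκ : ℵ₀ ≤ κ) :
    (∃ V : X → Set (Set X),
      (∀ x : X, #(V x) ≤ κ ∧ ∀ U ∈ V x, IsOpen U ∧ x ∈ U) ∧
      ∀ x y : X, x ≠ y →
        (⋂ U ∈ V x, closure U) ∩ (⋂ U ∈ V y, closure U) = ∅) ↔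
    (∀ x : X, ∃ 𝒰 : Set (Set X), #𝒰 ≤ κ ∧
      (∀ U ∈ 𝒰, IsOpen U ∧ x ∈ U) ∧ (⋂ U ∈ 𝒰, closure U) = {x}) := by
  constructor
  · rintro ⟨V, hV, hdisj⟩ x
    have mem_self (z : X) : z ∈ ⋂ U ∈ V z, closure U :=
      mem_iInter₂.2 fun U hU => subset_closure ((hV z).2 U hU).2
    refine ⟨V x, (hV x).1, (hV x).2, Subset.antisymm (fun y hy => ?_)
      (singleton_subset_iff.2 (mem_self x))⟩
    by_contra hne
    have hmem : y ∈ (⋂ U ∈ V x, closure U) ∩ (⋂ U ∈ V y, closure U) := ⟨hy, mem_self y⟩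
    rw [hdisj x y (Ne.symm hne)] at hmem
    exact hmem
  · intro h
    choose V hcard hnhds hinter using h
    refine ⟨V, fun x => ⟨hcard x, hnhds x⟩, fun x y hxy => ?_⟩
    rw [hinter x, hinter y]
    exact (disjoint_singleton.2 hxy).inter_eq
end

section
/- Let n ≥ 2 be an integer, κ and λ infinite cardinals, and X a topological space such that: (1) for every p ∈ X there exists a family 𝒱_p of open neighborhoods of p with |𝒱_p| ≤ κ such that for any n pairwise distinct points x₁,…,xₙ ∈ X one has (⋂_{V ∈ 𝒱_{x₁}} cl V) ∩ … ∩ (⋂_{V ∈ 𝒱_{xₙ}} cl V) = ∅; and (2) there exists a subset S ⊆ X with |S| ≤ λ and X = ⋃{cl(A) : A ⊆ S, |A| ≤ κ}. Then |X| ≤ λ^κ. -/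
open Set Cardinal

universe u

/-- If no fibre of a map contains `n` distinct points, its domain has cardinality at
most any infinite bound on the cardinality of its codomain. -/
theorem mk_le_of_no_injective_into_fiber {X Y : Type u} (f : X → Y) (n : ℕ) {c : Cardinal.{u}}
    (hc : ℵ₀ ≤ c) (hY : #Y ≤ c)
    (hf : ∀ x : Fin n → X, Function.Injective x → ¬ ∀ i j, f (x i) = f (x j)) : #X ≤ c := by
  have hfiber : ∀ y : Y, #{x // f x = y} ≤ ℵ₀ := by
    intro y
    by_contra! h
    have : Infinite {x // f x = y} := Cardinal.infinite_iff.2 h.le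
    let e := Infinite.natEmbedding {x // f x = y}
    refine hf (fun i => (e i : X)) (fun i j hij => Fin.ext (e.injective (Subtype.ext hij))) ?_
    intro i j
    exact (e i).2.trans (e j).2.symm
  calc #X = #(Σ y : Y, {x // f x = y}) := (Cardinal.mk_congr (Equiv.sigmaFiberEquiv f)).symm
    _ = Cardinal.sum fun y : Y => #{x // f x = y} := Cardinal.mk_sigma _
    _ ≤ Cardinal.sum fun _ : Y => ℵ₀ := Cardinal.sum_le_sum _ _ hfiber
    _ = #Y * ℵ₀ := by simp
    _ ≤ c * c := mul_le_mul' hY hc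
    _ = c := Cardinal.mul_eq_self hc

/-- Theorem 3.8 of the paper: if every point `p` of `X` has a
family `𝒱 p` of at most `κ` open neighbourhoods such that the closed
intersections over any `n` distinct points are empty, and `X` is covered by the
closures of the `≤ κ`-sized subsets of some set `S` with `|S| ≤ λ`, then
`|X| ≤ λ^κ`. -/
theorem card_le_of_families_and_cover (n : ℕ) (hn : 2 ≤ n)
    (X : Type u) [TopologicalSpace X]
    (κ lam : Cardinal.{u}) (hκ : ℵ₀ ≤ κ) (hlam : ℵ₀ ≤ lam)
    (h1 : ∃ 𝒱 : X → Set (Set X),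
      (∀ p : X, #(𝒱 p) ≤ κ ∧ ∀ V ∈ 𝒱 p, IsOpen V ∧ p ∈ V) ∧
      ∀ x : Fin n → X, Function.Injective x →
        (⋂ i, ⋂ V ∈ 𝒱 (x i), closure V) = ∅)
    (h2 : ∃ S : Set X, #S ≤ lam ∧
      (⋃ A ∈ {A : Set X | A ⊆ S ∧ #A ≤ κ}, closure A) = Set.univ) :
    #X ≤ lam ^ κ := by
  obtain ⟨𝒱, h𝒱, hdisj⟩ := h1
  obtain ⟨S, hS, hcover⟩ := h2
  have hA : ∀ p : X, ∃ A : Set X, (A ⊆ S ∧ #A ≤ κ) ∧ p ∈ closure A := by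
    intro p
    have hp : p ∈ ⋃ A ∈ {A : Set X | A ⊆ S ∧ #A ≤ κ}, closure A := hcover ▸ Set.mem_univ p
    simpa only [Set.mem_iUnion, exists_prop, Set.mem_ofPred_eq] using hp
  choose A hAS hpA using hA
  let T : Set (Set X) := {t | t ⊆ S ∧ #t ≤ κ}
  have hlamκ : ℵ₀ ≤ lam ^ κ :=
    hlam.trans (Cardinal.self_le_power lam (Cardinal.one_le_aleph0.trans hκ))
  have hT : #T ≤ lam ^ κ := (Cardinal.mk_bounded_subset_le S κ).trans
    (Cardinal.power_le_power_right (max_le hS hlam))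
  have hTT : #{F : Set (Set X) // F ⊆ T ∧ #F ≤ κ} ≤ lam ^ κ :=
    calc _ ≤ max #T ℵ₀ ^ κ := Cardinal.mk_bounded_subset_le T κ
      _ ≤ (lam ^ κ) ^ κ := Cardinal.power_le_power_right (max_le hT hlamκ)
      _ = lam ^ κ := by rw [← Cardinal.power_mul, Cardinal.mul_eq_self hκ]
  let traces : X → {F : Set (Set X) // F ⊆ T ∧ #F ≤ κ} := fun p =>
    ⟨(fun V => V ∩ A p) '' 𝒱 p, by
      rintro _ ⟨V, -, rfl⟩
      exact ⟨Set.inter_subset_right.trans (hAS p).1,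
        (Cardinal.mk_le_mk_of_subset Set.inter_subset_right).trans (hAS p).2⟩,
      Cardinal.mk_image_le.trans (h𝒱 p).1⟩
  refine mk_le_of_no_injective_into_fiber traces n hlamκ hTT fun x hx heq => ?_
  let i₀ : Fin n := ⟨0, by omega⟩
  have hmem : x i₀ ∈ ⋂ i, ⋂ V ∈ 𝒱 (x i), closure V := by
    simp only [Set.mem_iInter]
    intro i V hV
    have hVF : V ∩ A (x i) ∈ (traces (x i₀)).1 := heq i i₀ ▸ Set.mem_image_of_mem _ hV
    obtain ⟨W, hW, hWV⟩ := hVF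
    obtain ⟨hWo, hxW⟩ := (h𝒱 (x i₀)).2 W hW
    have hcl : x i₀ ∈ closure (W ∩ A (x i₀)) := hWo.inter_closure ⟨hxW, hpA _⟩
    exact closure_mono (hWV.subset.trans Set.inter_subset_left) hcl
  rw [hdisj x hx] at hmem
  exact hmem
end

section
/- Let n ≥ 2 be an integer, X an n-Urysohn topological space, and κ, λ infinite cardinals. If X has a dense subset D with |D| ≤ λ, n-ψ_c(X) ≤ κ, and t(X) ≤ κ, then |X| ≤ λ^κ. -/
open Set Cardinal

universe u

/-- `X` is `n`-Urysohn. -/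
def NUrysohn (X : Type u) [TopologicalSpace X] (n : ℕ) : Prop :=
  ∀ x : Fin n → X, Function.Injective x →
    ∃ U : Fin n → Set X, (∀ i, IsOpen (U i) ∧ x i ∈ U i) ∧
      (⋂ i, closure (U i)) = ∅

/-- `n-ψ_c(X) ≤ κ`. -/
def NPsiCLe (X : Type u) [TopologicalSpace X] (n : ℕ) (κ : Cardinal.{u}) : Prop :=
  ∃ V : X → Set (Set X),
    (∀ x : X, #(V x) ≤ κ ∧ ∀ U ∈ V x, IsOpen U ∧ x ∈ U) ∧
    ∀ x : Fin n → X, Function.Injective x →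
      (⋂ i, ⋂ U ∈ V (x i), closure U) = ∅

/-- an `n`-Urysohn space `X` with a dense set of cardinality
`≤ λ`, `n-ψ_c(X) ≤ κ` and `t(X) ≤ κ` satisfies `|X| ≤ λ^κ`. -/
theorem card_le_density_pow_nPsiC_t (n : ℕ) (hn : 2 ≤ n)
    (X : Type u) [TopologicalSpace X] (hX : NUrysohn X n)
    (κ lam : Cardinal.{u}) (hκ : ℵ₀ ≤ κ) (hlam : ℵ₀ ≤ lam)
    (D : Set X) (hD : Dense D) (hDcard : #D ≤ lam)
    (hpsi : NPsiCLe X n κ) (ht : TightnessLe X κ) :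
    #X ≤ lam ^ κ := by
  obtain ⟨V, hV, hVn⟩ := hpsi
  have key : ∀ (x : X) (U : V x), ∃ B : {B : Set D // #B ≤ κ},
      Subtype.val '' B.1 ⊆ U.1 ∧ x ∈ closure (Subtype.val '' B.1) := by
    intro x U
    obtain ⟨hUo, hxU⟩ := (hV x).2 U.1 U.2
    obtain ⟨B, hB, hBc, hxB⟩ := ht x (U.1 ∩ D) (hD.open_subset_closure_inter hUo hxU)
    have himg : (Subtype.val : D → X) '' (Subtype.val ⁻¹' B) = B := by
      rw [Subtype.image_preimage_coe]
      exact inter_eq_right.2 (hB.trans inter_subset_right)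
    refine ⟨⟨Subtype.val ⁻¹' B,
      (mk_preimage_of_injective _ _ Subtype.val_injective).trans hBc⟩, ?_, ?_⟩
    · rw [himg]
      exact hB.trans inter_subset_left
    · rwa [himg]
  choose B hBU hxB using key
  let F : X → {T : Set {B : Set D // #B ≤ κ} // #T ≤ κ} :=
    fun x => ⟨range (B x), mk_range_le.trans (hV x).1⟩
  have hfiber : ∀ T, #(F ⁻¹' {T}) ≤ ℵ₀ := by
    intro T
    have hfin : Finite (F ⁻¹' {T}) := by
      by_contra h
      rw [not_finite_iff_infinite] at h
      let e := Infinite.natEmbedding (F ⁻¹' {T})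
      let x : Fin n → X := fun i => (e i).1
      have hx : Function.Injective x :=
        Subtype.val_injective.comp (e.injective.comp Fin.val_injective)
      have hF : ∀ i j, range (B (x i)) = range (B (x j)) := fun i j =>
        congrArg Subtype.val ((e i).2.trans (e j).2.symm)
      have hmem : x ⟨0, by omega⟩ ∈ ⋂ i, ⋂ U ∈ V (x i), closure U := by
        simp only [mem_iInter]
        intro i U hU
        obtain ⟨W, hW⟩ : B (x i) ⟨U, hU⟩ ∈ range (B (x ⟨0, by omega⟩)) :=
          hF i ⟨0, by omega⟩ ▸ mem_range_self _
        have hmemW := hxB (x ⟨0, by omega⟩) W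
        rw [hW] at hmemW
        exact closure_mono (hBU (x i) ⟨U, hU⟩) hmemW
      rw [hVn x hx] at hmem
      exact hmem
    exact mk_le_aleph0
  have hpow : ℵ₀ ≤ lam ^ κ :=
    hlam.trans (self_le_power lam (one_le_aleph0.trans hκ))
  have hsmall : #{B : Set D // #B ≤ κ} ≤ lam ^ κ :=
    (mk_bounded_set_le D κ).trans (power_le_power_right (max_le hDcard hlam))
  have hfam : #{T : Set {B : Set D // #B ≤ κ} // #T ≤ κ} ≤ lam ^ κ := by
    refine (mk_bounded_set_le _ κ).trans
      ((power_le_power_right (max_le hsmall hpow)).trans ?_)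
    rw [← power_mul, mul_eq_self hκ]
  calc #X ≤ #{T : Set {B : Set D // #B ≤ κ} // #T ≤ κ} * ℵ₀ :=
        mk_le_mk_mul_of_mk_preimage_le F hfiber
    _ ≤ lam ^ κ * lam ^ κ := mul_le_mul' hfam hpow
    _ = lam ^ κ := mul_eq_self hpow
end

section
/- Let n ≥ 2 be an integer, X an n-Urysohn topological space, and κ, λ infinite cardinals. If X has a dense subset D with |D| ≤ λ and χ(X) ≤ κ, then |X| ≤ λ^κ. -/
open Set Cardinal

universe u

/-- The character of `X` is at most `κ`: every point has a neighbourhood base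
of cardinality `≤ κ`. -/
def CharLe (X : Type u) [TopologicalSpace X] (κ : Cardinal.{u}) : Prop :=
  ∀ x : X, ∃ ℬ : Set (Set X), #ℬ ≤ κ ∧ (∀ B ∈ ℬ, B ∈ nhds x) ∧
    ∀ U ∈ nhds x, ∃ B ∈ ℬ, B ⊆ U

/-- If the character is at most `#ι`, every point has a neighbourhood base indexed by `ι`. -/
theorem CharLe.exists_indexed_basis {X : Type u} [TopologicalSpace X] {ι : Type u}
    (h : CharLe X #ι) (x : X) :
    ∃ b : ι → Set X, (∀ a, b a ∈ nhds x) ∧ ∀ U ∈ nhds x, ∃ a, b a ⊆ U := by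
  obtain ⟨ℬ, ⟨e⟩, hmem, hbasis⟩ := h x
  obtain ⟨B, hB, -⟩ := hbasis univ Filter.univ_mem
  have : Nonempty ℬ := ⟨⟨B, hB⟩⟩
  refine ⟨fun a => (Function.invFun e a : ℬ), fun a => hmem _ (Function.invFun e a).2,
    fun U hU => ?_⟩
  obtain ⟨C, hC, hCU⟩ := hbasis U hU
  refine ⟨e ⟨C, hC⟩, ?_⟩
  simpa only [Function.leftInverse_invFun e.injective ⟨C, hC⟩] using hCU

/-- Points chosen in the pairwise intersections of basic neighbourhoods of `x` determine `x`
up to finitely many possibilities in an `n`-Urysohn space. -/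
theorem NUrysohn.finite_fiber {X : Type u} [TopologicalSpace X] {n : ℕ} (hn : 0 < n)
    (hX : NUrysohn X n) {ι : Type*} {D : Set X} {b : X → ι → Set X}
    (hb : ∀ x, ∀ U ∈ nhds x, ∃ a, b x a ⊆ U) {f : X → ι × ι → D}
    (hf : ∀ x p, (f x p : X) ∈ b x p.1 ∩ b x p.2) (g : ι × ι → D) :
    (f ⁻¹' {g}).Finite := by
  by_contra hinf
  have : Infinite (f ⁻¹' {g}) := Set.infinite_coe_iff.mpr hinf
  let e := Infinite.natEmbedding (f ⁻¹' {g})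
  let x : Fin n → X := fun i => e i
  have hx : Function.Injective x := fun i j h =>
    Fin.val_injective (e.injective (Subtype.val_injective h))
  have hg : ∀ i, f (x i) = g := fun i => (e i).2
  obtain ⟨U, hU, hempty⟩ := hX x hx
  suffices x ⟨0, hn⟩ ∈ ⋂ i, closure (U i) by simp [hempty] at this
  refine mem_iInter.mpr fun i => mem_closure_iff_nhds.mpr fun V hV => ?_
  obtain ⟨a, ha⟩ := hb (x i) (U i) ((hU i).1.mem_nhds (hU i).2)
  obtain ⟨c, hc⟩ := hb (x ⟨0, hn⟩) V hV
  refine ⟨g (a, c), hc ?_, ha ?_⟩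
  · exact hg ⟨0, hn⟩ ▸ (hf (x ⟨0, hn⟩) (a, c)).2
  · exact hg i ▸ (hf (x i) (a, c)).1

/-- an `n`-Urysohn space `X` with a dense set of cardinality `≤ λ`
and `χ(X) ≤ κ` satisfies `|X| ≤ λ^κ`. -/
theorem card_le_density_pow_character (n : ℕ) (hn : 2 ≤ n)
    (X : Type u) [TopologicalSpace X] (hX : NUrysohn X n)
    (κ lam : Cardinal.{u}) (hκ : ℵ₀ ≤ κ) (hlam : ℵ₀ ≤ lam)
    (D : Set X) (hD : Dense D) (hDcard : #D ≤ lam)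
    (hchi : CharLe X κ) :
    #X ≤ lam ^ κ := by
  induction κ using Cardinal.inductionOn with | _ ι
  choose b hmem hbasis using hchi.exists_indexed_basis
  have hpoint (x : X) (p : ι × ι) : ∃ d : D, (d : X) ∈ b x p.1 ∩ b x p.2 := by
    obtain ⟨d, hd, hdb⟩ := hD.inter_nhds_nonempty (Filter.inter_mem (hmem x p.1) (hmem x p.2))
    exact ⟨⟨d, hd⟩, hdb⟩
  choose f hf using hpoint
  have hfiber (g : ι × ι → D) : #(f ⁻¹' {g}) ≤ ℵ₀ :=
    (hX.finite_fiber (by omega) hbasis hf g).lt_aleph0.le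
  have hpow : ℵ₀ ≤ lam ^ #ι :=
    hlam.trans (self_le_power lam (one_le_aleph0.trans hκ))
  calc #X ≤ #(ι × ι → D) * ℵ₀ := mk_le_mk_mul_of_mk_preimage_le f hfiber
    _ = #D ^ #ι * ℵ₀ := by simp [mul_eq_self hκ]
    _ ≤ lam ^ #ι * lam ^ #ι := mul_le_mul' (power_le_power_right hDcard) hpow
    _ = lam ^ #ι := mul_eq_self hpow
end

section
/- Let n ≥ 2 be an integer, X an n-Urysohn topological space, and κ, λ infinite cardinals. If X has a dense subset D with |D| ≤ λ, πχ(X) ≤ κ, and n-ψ_c(X) ≤ κ, then |X| ≤ λ^κ. -/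
open Set Cardinal

universe u

/-- The π-character of `X` is at most `κ`: every point has a local π-base of
cardinality `≤ κ`. -/
def PiCharLe (X : Type u) [TopologicalSpace X] (κ : Cardinal.{u}) : Prop :=
  ∀ x : X, ∃ 𝒰 : Set (Set X), #𝒰 ≤ κ ∧ (∀ U ∈ 𝒰, IsOpen U ∧ U.Nonempty) ∧
    ∀ W : Set X, IsOpen W → x ∈ W → ∃ U ∈ 𝒰, U ⊆ W

/-- Under `PiCharLe X κ`, every point `x` has a set `A V` of at most `κ` points of the dense set `D`
inside each open neighborhood `V`, with `x` in its closure. -/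
theorem PiCharLe.exists_subset_dense {X : Type u} [TopologicalSpace X] {κ : Cardinal.{u}}
    (hpi : PiCharLe X κ) {D : Set X} (hD : Dense D) {x : X} {V : Set X} (hV : IsOpen V)
    (hx : x ∈ V) :
    ∃ A : Set D, #A ≤ κ ∧ (∀ d ∈ A, (d : X) ∈ V) ∧ x ∈ closure ((↑) '' A : Set X) := by
  obtain ⟨B, hBcard, hB, hBx⟩ := hpi x
  have hpick : ∀ U : B, ∃ d : D, (d : X) ∈ (U : Set X) := fun U ↦ by
    obtain ⟨d, hdD, hdU⟩ := hD.exists_mem_open (hB U U.2).1 (hB U U.2).2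
    exact ⟨⟨d, hdD⟩, hdU⟩
  choose d hd using hpick
  refine ⟨d '' {U | (U : Set X) ⊆ V}, (mk_image_le.trans (mk_set_le _)).trans hBcard, ?_, ?_⟩
  · rintro _ ⟨U, hU, rfl⟩
    exact hU (hd U)
  · rw [mem_closure_iff]
    intro W hW hxW
    obtain ⟨U, hU, hUW⟩ := hBx (W ∩ V) (hW.inter hV) ⟨hxW, hx⟩
    exact ⟨d ⟨U, hU⟩, (hUW (hd ⟨U, hU⟩)).1, _, ⟨⟨U, hU⟩, fun y hy ↦ (hUW hy).2, rfl⟩, rfl⟩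

/-- There are at most `c ^ κ` subsets of cardinality `≤ κ` of a type of cardinality `≤ c`. -/
theorem mk_bounded_set_le_pow {α : Type u} {c κ : Cardinal.{u}} (hα : #α ≤ c) (hc : ℵ₀ ≤ c) :
    #{t : Set α // #t ≤ κ} ≤ c ^ κ :=
  (mk_bounded_set_le α κ).trans (power_le_power_right (max_le hα hc))

/-- an `n`-Urysohn space `X` with a dense set of cardinality
`≤ λ`, `πχ(X) ≤ κ` and `n-ψ_c(X) ≤ κ` satisfies `|X| ≤ λ^κ`. -/
theorem card_le_density_pow_piChar_nPsiC (n : ℕ) (hn : 2 ≤ n)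
    (X : Type u) [TopologicalSpace X] (hX : NUrysohn X n)
    (κ lam : Cardinal.{u}) (hκ : ℵ₀ ≤ κ) (hlam : ℵ₀ ≤ lam)
    (D : Set X) (hD : Dense D) (hDcard : #D ≤ lam)
    (hpi : PiCharLe X κ) (hpsi : NPsiCLe X n κ) :
    #X ≤ lam ^ κ := by
  obtain ⟨V, hV, hVn⟩ := hpsi
  have hpow : ℵ₀ ≤ lam ^ κ :=
    hlam.trans (self_le_power lam (one_le_aleph0.trans hκ))
  have hex : ∀ (x : X) (U : V x), ∃ A : Set D,
      #A ≤ κ ∧ (∀ d ∈ A, (d : X) ∈ (U : Set X)) ∧ x ∈ closure ((↑) '' A : Set X) :=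
    fun x U ↦ hpi.exists_subset_dense hD ((hV x).2 U U.2).1 ((hV x).2 U U.2).2
  choose A hAcard hAU hxA using hex
  let Φ : X → {s : Set {t : Set D // #t ≤ κ} // #s ≤ κ} := fun x ↦
    ⟨range fun U : V x ↦ ⟨A x U, hAcard x U⟩, mk_range_le.trans (hV x).1⟩
  have hfib : ∀ s, #(Φ ⁻¹' {s}) ≤ ℵ₀ := by
    intro s
    refine le_of_lt (lt_aleph0_iff_set_finite.2 (not_infinite.1 fun hinf ↦ ?_))
    have := hinf.to_subtype
    let e := Infinite.natEmbedding (Φ ⁻¹' {s})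
    let x : Fin n → X := fun i ↦ e i
    have hx : Function.Injective x := fun i j hij ↦
      Fin.ext (e.injective (Subtype.ext hij))
    have hmem : x ⟨0, by lia⟩ ∈ ⋂ i, ⋂ U ∈ V (x i), closure U := by
      simp only [mem_iInter]
      intro i U hU
      have heq : Φ (x i) = Φ (x ⟨0, by lia⟩) := (e i).2.trans (e 0).2.symm
      have hin : (⟨A (x i) ⟨U, hU⟩, hAcard _ _⟩ : {t : Set D // #t ≤ κ}) ∈
          (Φ (x ⟨0, by lia⟩)).1 := heq ▸ ⟨⟨U, hU⟩, rfl⟩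
      obtain ⟨W, hW⟩ := hin
      have hxW := hxA (x ⟨0, by lia⟩) W
      have hAeq : A (x ⟨0, by lia⟩) W = A (x i) ⟨U, hU⟩ := congrArg Subtype.val hW
      rw [hAeq] at hxW
      refine closure_mono ?_ hxW
      rintro _ ⟨d, hd, rfl⟩
      exact hAU _ _ d hd
    rw [hVn x hx] at hmem
    exact hmem
  calc #X ≤ #{s : Set {t : Set D // #t ≤ κ} // #s ≤ κ} * ℵ₀ :=
        mk_le_mk_mul_of_mk_preimage_le Φ hfib
    _ ≤ (lam ^ κ) ^ κ * ℵ₀ :=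
        mul_le_mul_left (mk_bounded_set_le_pow (mk_bounded_set_le_pow hDcard hlam) hpow) _
    _ = lam ^ κ := by
        rw [← power_mul, mul_eq_self hκ, mul_aleph0_eq hpow]
end

section
/- Let n ≥ 2 be an integer, X an n-Urysohn topological space, and κ, λ infinite cardinals. If πχ(X) ≤ λ, c(X) ≤ κ, and χ(X) ≤ κ, then |X| ≤ λ^κ. -/
open Set Cardinal

universe u

/-- The cellularity of `X` is at most `κ`: every pairwise disjoint family of
nonempty open sets has cardinality `≤ κ`. -/
def CellularityLe (X : Type u) [TopologicalSpace X] (κ : Cardinal.{u}) : Prop :=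
  ∀ 𝒰 : Set (Set X), (∀ U ∈ 𝒰, IsOpen U ∧ U.Nonempty) →
    𝒰.PairwiseDisjoint id → #𝒰 ≤ κ

/-- A family of nonempty open sets has a subfamily of size bounded by the cellularity whose union
meets every member of the family. -/
theorem CellularityLe.exists_subfamily {X : Type u} [TopologicalSpace X] {κ : Cardinal.{u}}
    (hc : CellularityLe X κ) (T : Set (Set X)) (hT : ∀ U ∈ T, IsOpen U ∧ U.Nonempty) :
    ∃ 𝒲 ⊆ T, #𝒲 ≤ κ ∧ ∀ U ∈ T, (U ∩ ⋃₀ 𝒲).Nonempty := by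
  obtain ⟨𝒲, hmax⟩ := zorn_subset {𝒲 : Set (Set X) | 𝒲 ⊆ T ∧ 𝒲.PairwiseDisjoint id} (by
    intro c hcS hchain
    refine ⟨⋃₀ c, ⟨sUnion_subset fun s hs => (hcS hs).1, ?_⟩, fun s hs => subset_sUnion_of_mem hs⟩
    exact (pairwiseDisjoint_sUnion hchain.directedOn).2 fun s hs => (hcS hs).2)
  obtain ⟨hWT, hWd⟩ := hmax.prop
  refine ⟨𝒲, hWT, hc 𝒲 (fun U hU => hT U (hWT hU)) hWd, fun U hU => ?_⟩
  by_contra hne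
  rw [not_nonempty_iff_eq_empty, ← disjoint_iff_inter_eq_empty] at hne
  have hins : insert U 𝒲 ∈ {𝒲 : Set (Set X) | 𝒲 ⊆ T ∧ 𝒲.PairwiseDisjoint id} :=
    ⟨insert_subset hU hWT, hWd.insert fun W hW _ => hne.mono_right (subset_sUnion_of_mem hW)⟩
  have hUW : U ∈ 𝒲 := hmax.le_of_ge hins (subset_insert U 𝒲) (mem_insert U 𝒲)
  have := hne.mono_right (subset_sUnion_of_mem hUW)
  exact (hT U hU).2.ne_empty (disjoint_self.1 this)

/-- For every `κ`-ary operation with parameters there is a nonempty set of size at most `lam ^ κ`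
closed under it. -/
theorem exists_closed_under_op {X K Λ : Type u} [Nonempty X] (hK : ℵ₀ ≤ #K) (hΛ : ℵ₀ ≤ #Λ)
    (e : (K → X) → (K → Λ) → X) :
    ∃ A : Set X, A.Nonempty ∧ #A ≤ #Λ ^ #K ∧ ∀ f g, (∀ k, f k ∈ A) → e f g ∈ A := by
  let β : Option (K → Λ) → Type u := fun o => o.elim PEmpty fun _ => K
  let step : (Σ a : Option (K → Λ), β a → X) → X := fun
    | ⟨none, _⟩ => Classical.arbitrary X
    | ⟨some g, f⟩ => e f g
  let ev : WType β → X := WType.elim X step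
  have hinf : ℵ₀ ≤ #Λ ^ #K := hΛ.trans (self_le_power _ (one_le_aleph0.trans hK))
  have hpow : (#Λ ^ #K) ^ #K = #Λ ^ #K := by rw [← power_mul, mul_eq_self hK]
  refine ⟨range ev, ⟨ev (WType.mk none PEmpty.elim), mem_range_self _⟩, ?_, ?_⟩
  · refine mk_range_le.trans (WType.cardinalMk_le_of_le ?_)
    calc Cardinal.sum (fun a => (#Λ ^ #K) ^ #(β a))
        ≤ Cardinal.sum (fun _ : Option (K → Λ) => #Λ ^ #K) := by
          refine sum_le_sum _ _ fun a => ?_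
          cases a with
          | none => simpa [β] using one_le_aleph0.trans hinf
          | some g => exact hpow.le
      _ = #Λ ^ #K := by
          have : #(Option (K → Λ)) = #Λ ^ #K := by
            rw [mk_option, ← power_def, add_one_eq hinf]
          rw [sum_const', this, mul_eq_self hinf]
  · intro f g hf
    choose w hw using hf
    refine ⟨WType.mk (some g) w, ?_⟩
    rw [← funext hw]
    rfl

/-- A nonempty family of cardinality at most `#K` is the range of a map from `K`. -/
theorem exists_range_eq_of_mk_le {α K : Type u} {s : Set α} (hs : s.Nonempty) (h : #s ≤ #K) :
    ∃ f : K → α, range f = s := by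
  obtain ⟨i⟩ := h
  have := hs.to_subtype
  refine ⟨fun k => (Function.invFun i k : s), ?_⟩
  have hsurj := Function.invFun_surjective i.injective
  rw [range_comp' Subtype.val, hsurj.range_eq, image_univ, Subtype.range_coe]

/-- The θ-density of a space is at most `πχ(X) ^ c(X)`. -/
theorem exists_theta_dense {X K Λ : Type u} [TopologicalSpace X] (hK : ℵ₀ ≤ #K) (hΛ : ℵ₀ ≤ #Λ)
    (hpi : PiCharLe X #Λ) (hc : CellularityLe X #K) :
    ∃ D : Set X, #D ≤ #Λ ^ #K ∧ ∀ V, IsOpen V → V.Nonempty → (closure V ∩ D).Nonempty := by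
  classical
  cases isEmpty_or_nonempty X with
  | inl h => exact ⟨∅, by simp, fun V _ ⟨x, _⟩ => h.elim x⟩
  | inr h =>
  choose P hPcard hPopen hP using hpi
  have hPne (x : X) : (P x).Nonempty :=
    let ⟨U, hU, _⟩ := hP x univ isOpen_univ (mem_univ x)
    ⟨U, hU⟩
  choose B hB using fun x => exists_range_eq_of_mk_le (hPne x) (hPcard x)
  let G (f : K → X) (g : K → Λ) : Set X := closure (⋃ k, B (f k) (g k))
  let e (f : K → X) (g : K → Λ) : X :=
    if h : (G f g)ᶜ.Nonempty then h.some else Classical.arbitrary X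
  obtain ⟨A, hAne, hAcard, hA⟩ := exists_closed_under_op hK hΛ e
  refine ⟨A, hAcard, fun V hV ⟨v, hv⟩ => ?_⟩
  by_contra hVA
  rw [not_nonempty_iff_eq_empty, ← disjoint_iff_inter_eq_empty] at hVA
  obtain ⟨𝒲, hWT, hWcard, hW⟩ := hc.exists_subfamily {U | (∃ a ∈ A, U ∈ P a) ∧ Disjoint U V}
    fun U ⟨⟨a, _, hU⟩, _⟩ => hPopen a U hU
  have hAW : A ⊆ closure (⋃₀ 𝒲) := by
    intro a ha
    rw [mem_closure_iff]
    intro O hO haO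
    obtain ⟨U, hU, hUO⟩ := hP a (O ∩ (closure V)ᶜ) (hO.inter isClosed_closure.isOpen_compl)
      ⟨haO, fun h => hVA.notMem_of_mem_left h ha⟩
    have hUV : Disjoint U V := disjoint_left.2 fun x hx hxV => (hUO hx).2 (subset_closure hxV)
    exact (hW U ⟨⟨a, ha, hU⟩, hUV⟩).mono (inter_subset_inter_left _ (hUO.trans inter_subset_left))
  have hWne : 𝒲.Nonempty := by
    obtain ⟨a, ha⟩ := hAne
    obtain ⟨x, W, hW, _⟩ := closure_nonempty_iff.1 ⟨a, hAW ha⟩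
    exact ⟨W, hW⟩
  obtain ⟨w, hw⟩ := exists_range_eq_of_mk_le hWne hWcard
  have hwB (k : K) : ∃ a ∈ A, ∃ l, B a l = w k := by
    obtain ⟨⟨a, ha, hU⟩, _⟩ := hWT (hw ▸ mem_range_self k)
    exact ⟨a, ha, by rwa [← hB] at hU⟩
  choose f hf g hg using hwB
  have hG : G f g = closure (⋃₀ 𝒲) := by
    simp only [G, hg, ← hw, sUnion_range]
  have hvG : v ∈ (G f g)ᶜ := by
    rw [hG]
    refine disjoint_left.1 (Disjoint.closure_right ?_ hV) hv
    exact disjoint_sUnion_right.2 fun W hW => (hWT hW).2.symm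
  have hne : (G f g)ᶜ.Nonempty := ⟨v, hvG⟩
  have he : e f g ∈ (G f g)ᶜ := by
    simp only [e, dif_pos hne]
    exact hne.some_mem
  exact he (hG ▸ hAW (hA f g hf))

/-- A function with finite fibers does not decrease infinite cardinalities. -/
theorem mk_le_of_finite_fibers {X Y : Type u} {c : Cardinal.{u}} (hc : ℵ₀ ≤ c) (hY : #Y ≤ c)
    (f : X → Y) (hf : ∀ y, (f ⁻¹' {y}).Finite) : #X ≤ c := by
  rw [← mk_congr (Equiv.sigmaFiberEquiv f), mk_sigma]
  calc Cardinal.sum (fun y => #{x // f x = y})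
      ≤ Cardinal.sum (fun _ : Y => ℵ₀) := sum_le_sum _ _ fun y => (hf y).lt_aleph0.le
    _ ≤ c := by
      rw [sum_const']
      exact mul_le_of_le hc hY hc

/-- In an `n`-Urysohn space of character at most `κ`, a θ-dense set of size at most
`lam ^ κ` bounds the cardinality of the space. -/
theorem NUrysohn.mk_le_of_theta_dense {n : ℕ} (hn : n ≠ 0) {X K : Type u} [TopologicalSpace X]
    (hX : NUrysohn X n) (hK : ℵ₀ ≤ #K) (hchi : CharLe X #K) {lam : Cardinal.{u}} (hlam : ℵ₀ ≤ lam)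
    {D : Set X} (hDcard : #D ≤ lam ^ #K)
    (hD : ∀ V, IsOpen V → V.Nonempty → (closure V ∩ D).Nonempty) : #X ≤ lam ^ #K := by
  choose P hPcard hPnhds hP using hchi
  have hPne (x : X) : (P x).Nonempty :=
    let ⟨U, hU, _⟩ := hP x univ Filter.univ_mem
    ⟨U, hU⟩
  choose V hV using fun x => exists_range_eq_of_mk_le (hPne x) (hPcard x)
  have hVnhds (x : X) (k : K) : V x k ∈ nhds x := hPnhds x _ (hV x ▸ mem_range_self k)
  have hVbase (x : X) (U : Set X) (hU : U ∈ nhds x) : ∃ k, V x k ⊆ U := by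
    obtain ⟨B, hB, hBU⟩ := hP x U hU
    obtain ⟨k, rfl⟩ := (hV x).symm ▸ hB
    exact ⟨k, hBU⟩
  have hpt (x : X) (k : K) : ∃ d : D, (d : X) ∈ closure (V x k) := by
    obtain ⟨d, hd, hdD⟩ := hD (interior (V x k)) isOpen_interior
      ⟨x, mem_interior_iff_mem_nhds.2 (hVnhds x k)⟩
    exact ⟨⟨d, hdD⟩, closure_mono interior_subset hd⟩
  choose d hd using hpt
  have hinf : ℵ₀ ≤ lam ^ #K := hlam.trans (self_le_power _ (one_le_aleph0.trans hK))
  have hpow : (lam ^ #K) ^ #K = lam ^ #K := by rw [← power_mul, mul_eq_self hK]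
  have hset : #(Set K) ≤ lam ^ #K := by
    rw [mk_set]
    exact power_le_power_right ((natCast_le_aleph0 (n := 2)).trans hlam)
  let Φ (x : X) : (K → D) × (K → Set K) := (d x, fun k => {j | (d x j : X) ∈ closure (V x k)})
  refine mk_le_of_finite_fibers hinf ?_ Φ fun y => ?_
  · rw [mk_prod, lift_id, lift_id, ← power_def, ← power_def]
    refine mul_le_of_le hinf ?_ ?_
    · exact (power_le_power_right hDcard).trans hpow.le
    · exact (power_le_power_right hset).trans hpow.le
  · by_contra hfin
    have hfin : (Φ ⁻¹' {y}).Infinite := hfin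
    have := hfin.to_subtype
    let x (i : Fin n) : X := (Infinite.natEmbedding (Φ ⁻¹' {y}) i : Φ ⁻¹' {y})
    have hΦ (i : Fin n) : Φ (x i) = y := (Infinite.natEmbedding (Φ ⁻¹' {y}) i).2
    have hinj : Function.Injective x :=
      Subtype.val_injective.comp ((Infinite.natEmbedding _).injective.comp Fin.val_injective)
    obtain ⟨U, hU, hUempty⟩ := hX x hinj
    choose k hk using fun i => hVbase (x i) (U i) ((hU i).1.mem_nhds (hU i).2)
    let z : X := x ⟨0, Nat.pos_of_ne_zero hn⟩
    obtain ⟨j, hj⟩ := hVbase z (⋂ i, V z (k i)) (Filter.iInter_mem.2 fun i => hVnhds z (k i))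
    have hmem : (d z j : X) ∈ ⋂ i, closure (U i) := by
      refine mem_iInter.2 fun i => closure_mono (hk i) ?_
      have hz : j ∈ (Φ z).2 (k i) := closure_mono (hj.trans (iInter_subset _ i)) (hd z j)
      have hzi : Φ z = Φ (x i) := (hΦ _).trans (hΦ i).symm
      have hdz : d z j = d (x i) j := congrFun (congrArg Prod.fst hzi) j
      rw [hzi] at hz
      rw [hdz]
      exact hz
    rw [hUempty] at hmem
    exact hmem

/-- an `n`-Urysohn space `X` with `πχ(X) ≤ λ`, `c(X) ≤ κ` and
`χ(X) ≤ κ` satisfies `|X| ≤ λ^κ`. -/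
theorem card_le_piChar_pow_cell_char (n : ℕ) (hn : 2 ≤ n)
    (X : Type u) [TopologicalSpace X] (hX : NUrysohn X n)
    (κ lam : Cardinal.{u}) (hκ : ℵ₀ ≤ κ) (hlam : ℵ₀ ≤ lam)
    (hpi : PiCharLe X lam) (hc : CellularityLe X κ) (hchi : CharLe X κ) :
    #X ≤ lam ^ κ := by
  induction κ using Cardinal.inductionOn with
  | _ K
  induction lam using Cardinal.inductionOn with
  | _ Λ
  obtain ⟨D, hDcard, hD⟩ := exists_theta_dense hκ hlam hpi hc
  exact hX.mk_le_of_theta_dense (by omega) hκ hchi hlam hDcard hD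
end

section
/- Let n ≥ 2 be an integer and X an n-Urysohn topological space. Then the semiregularization X(s) is n-Urysohn, and for every infinite cardinal κ one has n-ψ_c(X) ≤ κ if and only if n-ψ_c(X(s)) ≤ κ (closures of open sets and of their semiregularization counterparts coincide, so the n-closed pseudocharacters of X and X(s) are equal). -/
open Set Cardinal

universe u

/-- `X` is `n`-Urysohn with respect to the topology `t`. -/
def NUrysohnT (X : Type u) (t : TopologicalSpace X) (n : ℕ) : Prop :=
  ∀ x : Fin n → X, Function.Injective x →
    ∃ U : Fin n → Set X, (∀ i, @IsOpen X t (U i) ∧ x i ∈ U i) ∧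
      (⋂ i, @closure X t (U i)) = ∅

/-- `n-ψ_c(X) ≤ κ` with respect to the topology `t`. -/
def NPsiCLeT (X : Type u) (t : TopologicalSpace X) (n : ℕ) (κ : Cardinal.{u}) : Prop :=
  ∃ V : X → Set (Set X),
    (∀ x : X, #(V x) ≤ κ ∧ ∀ U ∈ V x, @IsOpen X t U ∧ x ∈ U) ∧
    ∀ x : Fin n → X, Function.Injective x →
      (⋂ i, ⋂ U ∈ V (x i), @closure X t U) = ∅

/-- The semiregularization `X(s)` of `(X, t)`: the topology generated by the
regular open sets `int (cl U)`, `U` open in `t`. -/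
def Semireg (X : Type u) (t : TopologicalSpace X) : TopologicalSpace X :=
  TopologicalSpace.generateFrom
    {S : Set X | ∃ U : Set X, @IsOpen X t U ∧ S = @interior X t (@closure X t U)}

theorem isOpen_semireg_interior_closure {X : Type u} [t : TopologicalSpace X] {U : Set X}
    (hU : IsOpen U) : @IsOpen X (Semireg X t) (interior (closure U)) :=
  TopologicalSpace.isOpen_generateFrom_of_mem ⟨U, hU, rfl⟩

theorem le_semireg {X : Type u} (t : TopologicalSpace X) : t ≤ Semireg X t := by
  refine le_generateFrom ?_
  rintro _ ⟨U, -, rfl⟩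
  exact isOpen_interior

/-- An open set has the same closure in a space and in its semiregularization. -/
theorem closure_semireg_eq {X : Type u} [t : TopologicalSpace X] {U : Set X} (hU : IsOpen U) :
    @closure X (Semireg X t) U = closure U := by
  refine Subset.antisymm (fun x hx => mem_closure_iff.2 fun W hW hxW => ?_)
    (closure.mono (le_semireg t))
  obtain ⟨y, hyW, hyU⟩ := (@mem_closure_iff X (Semireg X t) _ _).1 hx _
    (isOpen_semireg_interior_closure hW) (hW.subset_interior_closure hxW)
  obtain ⟨z, hzU, hzW⟩ := mem_closure_iff.1 (interior_subset hyW) U hU hyU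
  exact ⟨z, hzW, hzU⟩

/-- The regular open hull of an open set has, in the semiregularization, the closure of that
set. -/
theorem closure_semireg_interior_closure {X : Type u} [t : TopologicalSpace X] {U : Set X}
    (hU : IsOpen U) : @closure X (Semireg X t) (interior (closure U)) = closure U :=
  (closure_semireg_eq isOpen_interior).trans <|
    (closure_minimal interior_subset isClosed_closure).antisymm
      (closure_mono hU.subset_interior_closure)

/-- if `X` is `n`-Urysohn then its semiregularization `X(s)` is
`n`-Urysohn and, for every infinite cardinal `κ`,
`n-ψ_c(X) ≤ κ ↔ n-ψ_c(X(s)) ≤ κ`. -/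
theorem semireg_nUrysohn_and_nPsiC (n : ℕ) (hn : 2 ≤ n)
    (X : Type u) (t : TopologicalSpace X) (hX : NUrysohnT X t n) :
    NUrysohnT X (Semireg X t) n ∧
      ∀ κ : Cardinal.{u}, ℵ₀ ≤ κ →
        (NPsiCLeT X t n κ ↔ NPsiCLeT X (Semireg X t) n κ) := by
  refine ⟨fun x hx => ?_, fun κ _ => ⟨?_, ?_⟩⟩
  · obtain ⟨U, hU, hdisj⟩ := hX x hx
    refine ⟨fun i => interior (closure (U i)), fun i =>
      ⟨isOpen_semireg_interior_closure (hU i).1,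
        (hU i).1.subset_interior_closure (hU i).2⟩, ?_⟩
    rw [← hdisj]
    exact iInter_congr fun i => closure_semireg_interior_closure (hU i).1
  · rintro ⟨V, hV, hdisj⟩
    refine ⟨fun x => (fun U => interior (closure U)) '' V x, fun x =>
      ⟨mk_image_le.trans (hV x).1, ?_⟩, fun x hx => ?_⟩
    · rintro _ ⟨U, hU, rfl⟩
      obtain ⟨hUo, hxU⟩ := (hV x).2 U hU
      exact ⟨isOpen_semireg_interior_closure hUo, hUo.subset_interior_closure hxU⟩
    · rw [← hdisj x hx]
      refine iInter_congr fun i => ?_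
      rw [biInter_image]
      exact iInter₂_congr fun U hU => closure_semireg_interior_closure ((hV (x i)).2 U hU).1
  · rintro ⟨V, hV, hdisj⟩
    have hopen : ∀ x, ∀ U ∈ V x, IsOpen U := fun x U hU => le_semireg t U ((hV x).2 U hU).1
    refine ⟨V, fun x => ⟨(hV x).1, fun U hU => ⟨hopen x U hU, ((hV x).2 U hU).2⟩⟩,
      fun x hx => ?_⟩
    rw [← hdisj x hx]
    exact iInter_congr fun i => iInter₂_congr fun U hU =>
      (closure_semireg_eq (hopen (x i) U hU)).symm
end

section
/- Let X be an H-closed space (i.e. a Hausdorff space such that every family of open sets covering X has a finite subfamily whose closures cover X) and κ an infinite cardinal with ψ_c(X) ≤ κ. Then in the semiregularization X(s) every point has a neighborhood base of cardinality ≤ κ; that is, χ(X(s)) ≤ ψ_c(X). -/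
open Set Cardinal

universe u

/-- `X` is H-closed: (Hausdorff, as an instance, and) every open cover has a
finite subfamily whose closures cover `X`. -/
def HClosedCovering (X : Type u) [TopologicalSpace X] : Prop :=
  ∀ 𝒰 : Set (Set X), (∀ U ∈ 𝒰, IsOpen U) → ⋃₀ 𝒰 = Set.univ →
    ∃ 𝒱 ⊆ 𝒰, 𝒱.Finite ∧ (⋃ V ∈ 𝒱, closure V) = Set.univ

/-- `ψ_c(X) ≤ κ`: every point has a family of at most `κ` open neighbourhoods
whose closures intersect exactly in that point. -/
def PsiCLe (X : Type u) [TopologicalSpace X] (κ : Cardinal.{u}) : Prop :=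
  ∀ x : X, ∃ 𝒰 : Set (Set X), #𝒰 ≤ κ ∧ (∀ U ∈ 𝒰, IsOpen U ∧ x ∈ U) ∧
    (⋂ U ∈ 𝒰, closure U) = {x}

/-- The character of `X` w.r.t. the topology `t` is at most `κ`: every point
has a neighbourhood base of cardinality `≤ κ`. -/
def CharLeT (X : Type u) (t : TopologicalSpace X) (κ : Cardinal.{u}) : Prop :=
  ∀ x : X, ∃ ℬ : Set (Set X), #ℬ ≤ κ ∧ (∀ B ∈ ℬ, B ∈ @nhds X t x) ∧
    ∀ U ∈ @nhds X t x, ∃ B ∈ ℬ, B ⊆ U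

/-- In an H-closed space, a regular open set containing the intersection of the closures of a
family `𝒰` contains the intersection of the sets `interior (closure U)` for `U` in a finite
subfamily of `𝒰`. -/
theorem HClosedCovering.exists_finite_biInter_subset {X : Type u} [TopologicalSpace X]
    (hH : HClosedCovering X) {𝒰 : Set (Set X)} {W : Set X}
    (h𝒰 : ⋂ U ∈ 𝒰, closure U ⊆ interior (closure W)) :
    ∃ 𝒱 ⊆ 𝒰, 𝒱.Finite ∧ ⋂ U ∈ 𝒱, interior (closure U) ⊆ interior (closure W) := by
  obtain ⟨𝒯, h𝒯, hfin, hcov⟩ := hH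
    (insert (interior (closure W)) ((fun U => (closure U)ᶜ) '' 𝒰)) (by
      rintro _ (rfl | ⟨U, -, rfl⟩)
      exacts [isOpen_interior, isClosed_closure.isOpen_compl]) (by
      refine eq_univ_of_forall fun y => ?_
      by_cases hy : y ∈ ⋂ U ∈ 𝒰, closure U
      · exact ⟨_, mem_insert _ _, h𝒰 hy⟩
      · simp only [mem_iInter, not_forall] at hy
        obtain ⟨U, hU, hyU⟩ := hy
        exact ⟨_, mem_insert_of_mem _ (mem_image_of_mem _ hU), hyU⟩)
  have hsub : ∀ T ∈ 𝒯 \ {interior (closure W)}, ∃ U ∈ 𝒰, (closure U)ᶜ = T := fun T hT =>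
    (h𝒯 hT.1).resolve_left hT.2
  choose! f hf𝒰 hf using hsub
  refine ⟨f '' (𝒯 \ {interior (closure W)}), image_subset_iff.2 hf𝒰, hfin.sdiff.image f, ?_⟩
  have hclosed : IsClosed (⋃ T ∈ 𝒯 \ {interior (closure W)}, closure T) :=
    hfin.sdiff.isClosed_biUnion fun _ _ => isClosed_closure
  have hcompl : (closure W)ᶜ ⊆ ⋃ T ∈ 𝒯 \ {interior (closure W)}, closure T := by
    intro y hy
    obtain ⟨T, hT, hyT⟩ := mem_iUnion₂.1 (hcov.symm ▸ mem_univ y)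
    refine mem_iUnion₂.2 ⟨T, ⟨hT, ?_⟩, hyT⟩
    rintro rfl
    exact hy (closure_minimal interior_subset isClosed_closure hyT)
  intro y hy
  by_contra hyW
  rw [← mem_compl_iff, ← closure_compl] at hyW
  obtain ⟨T, hT, hyT⟩ := mem_iUnion₂.1 (closure_minimal hcompl hclosed hyW)
  have hyf := mem_iInter₂.1 hy (f T) (mem_image_of_mem f hT)
  rw [← hf T hT, closure_compl] at hyT
  exact hyT hyf

/-- for an H-closed space `X` with `ψ_c(X) ≤ κ`, the
semiregularization `X(s)` has character at most `κ`. -/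
theorem char_semireg_le_psiC (X : Type u) [t : TopologicalSpace X] [T2Space X]
    (hH : HClosedCovering X) (κ : Cardinal.{u}) (hκ : ℵ₀ ≤ κ)
    (hpsi : PsiCLe X κ) :
    CharLeT X (Semireg X t) κ := by
  intro x
  obtain ⟨𝒰, hcard, hopen, hinter⟩ := hpsi x
  refine ⟨range fun l : List 𝒰 => ⋂ U ∈ l, interior (closure (U : Set X)), ?_, ?_, ?_⟩
  · exact mk_range_le.trans ((mk_list_le_max _).trans (max_le hκ hcard))
  · rintro _ ⟨l, rfl⟩
    refine (Filter.biInter_mem (List.finite_toSet l)).2 fun U _ => ?_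
    obtain ⟨hU, hxU⟩ := hopen U U.2
    exact @IsOpen.mem_nhds X (Semireg X t) _ _
      (TopologicalSpace.isOpen_generateFrom_of_mem ⟨U, hU, rfl⟩)
      (interior_maximal subset_closure hU hxU)
  · have hle : Filter.generate ((fun U => interior (closure U)) '' 𝒰) ≤
        @nhds X (Semireg X t) x := by
      rw [Semireg, TopologicalSpace.nhds_generateFrom]
      refine le_iInf₂ fun S hS => Filter.le_principal_iff.2 ?_
      obtain ⟨hxS, W, hW, rfl⟩ := hS
      obtain ⟨𝒱, h𝒱, hfin, hsub⟩ := hH.exists_finite_biInter_subset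
        (hinter.subset.trans (singleton_subset_iff.2 hxS))
      exact Filter.mem_of_superset ((Filter.biInter_mem hfin).2 fun U hU =>
        Filter.mem_generate_of_mem (mem_image_of_mem _ (h𝒱 hU))) hsub
    intro N hN
    have hlist : ∀ M, Filter.GenerateSets ((fun U => interior (closure U)) '' 𝒰) M →
        ∃ l : List 𝒰, ⋂ U ∈ l, interior (closure (U : Set X)) ⊆ M := by
      intro M hM
      induction hM with
      | basic h =>
        obtain ⟨U, hU, rfl⟩ := h
        exact ⟨[⟨U, hU⟩], by simp⟩
      | univ => exact ⟨[], subset_univ _⟩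
      | superset _ hst ih => exact ih.imp fun l hl => hl.trans hst
      | inter _ _ ih₁ ih₂ =>
        obtain ⟨l₁, h₁⟩ := ih₁
        obtain ⟨l₂, h₂⟩ := ih₂
        refine ⟨l₁ ++ l₂, subset_inter (Subset.trans ?_ h₁) (Subset.trans ?_ h₂)⟩
        · exact biInter_subset_biInter_left fun _ h => List.mem_append_left _ h
        · exact biInter_subset_biInter_left fun _ h => List.mem_append_right _ h
    obtain ⟨l, hl⟩ := hlist N (hle hN)
    exact ⟨_, mem_range_self l, hl⟩
end

section
/- Let n ≥ 2 be an integer, X an n-Urysohn topological space satisfying the n-H-closed covering property, and κ an infinite cardinal with n-Uψ(X) ≤ κ. Then |X| ≤ 2^κ. -/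
open Set Cardinal

universe u

/-- The `n`-H-closed covering property. -/
def NHClosedCovering (X : Type u) [TopologicalSpace X] (n : ℕ) : Prop :=
  ∀ A : Set X, #A ≤ ((n - 2 : ℕ) : Cardinal) →
    ∀ 𝒰 : Set (Set X), (∀ U ∈ 𝒰, IsOpen U) → Set.univ \ A ⊆ ⋃₀ 𝒰 →
      ∃ 𝒱 ⊆ 𝒰, 𝒱.Finite ∧ (⋃ V ∈ 𝒱, closure V) = Set.univ

/-- `n-Uψ(X) ≤ κ`: each point has a family of at most `κ` open neighbourhoods
such that for any `n` pairwise distinct points one can pick one member from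
each family with the closures having empty intersection. -/
def NUPsiLe (X : Type u) [TopologicalSpace X] (n : ℕ) (κ : Cardinal.{u}) : Prop :=
  ∃ V : X → Set (Set X),
    (∀ x : X, #(V x) ≤ κ ∧ ∀ U ∈ V x, IsOpen U ∧ x ∈ U) ∧
    ∀ x : Fin n → X, Function.Injective x →
      ∃ W : Fin n → Set X, (∀ i, W i ∈ V (x i)) ∧ (⋂ i, closure (W i)) = ∅

/-- A point lies in a set of size at most `2 ^ κ` closed under a given family of at most `2 ^ κ`
operations of arity at most `κ`. -/
theorem exists_mem_mk_le_closed_under_ops {X ι E : Type u} {κ : Cardinal.{u}}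
    (hκ : ℵ₀ ≤ κ) (hE : #E ≤ κ) (hι : #ι ≤ 2 ^ κ) (x₀ : X) (op : ι → (E → X) → X) :
    ∃ H : Set X, x₀ ∈ H ∧ #H ≤ 2 ^ κ ∧ ∀ a g, (∀ i, g i ∈ H) → op a g ∈ H := by
  let β : Option ι → Type u := fun o => o.elim PEmpty fun _ => E
  let step : (Σ o : Option ι, β o → X) → X := fun s =>
    match s with
    | ⟨none, _⟩ => x₀
    | ⟨some a, g⟩ => op a g
  let ev : WType β → X := WType.elim X step
  have hc : ℵ₀ ≤ (2 : Cardinal.{u}) ^ κ := hκ.trans (cantor κ).le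
  refine ⟨range ev, ⟨WType.mk none PEmpty.elim, rfl⟩, mk_range_le.trans ?_, ?_⟩
  · apply WType.cardinalMk_le_of_le
    have hβ : ∀ o, ((2 : Cardinal.{u}) ^ κ) ^ #(β o) ≤ 2 ^ κ := by
      intro o
      rw [← power_mul]
      refine power_le_power_left two_ne_zero ?_
      have : #(β o) ≤ κ := by
        cases o with
        | none => simp [β]
        | some a => exact hE
      exact (mul_le_mul_right this κ).trans (mul_eq_self hκ).le
    calc (sum fun o => ((2 : Cardinal.{u}) ^ κ) ^ #(β o))
        ≤ sum fun _ : Option ι => (2 : Cardinal.{u}) ^ κ := sum_le_sum _ _ hβ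
      _ = #(Option ι) * 2 ^ κ := by simp
      _ ≤ 2 ^ κ * 2 ^ κ := by
          gcongr
          rw [mk_option]
          exact (add_le_add hι (one_le_aleph0.trans hc)).trans (add_eq_self hc).le
      _ = 2 ^ κ := mul_eq_self hc
  · intro a g hg
    choose w hw using hg
    refine ⟨WType.mk (some a) w, ?_⟩
    change op a (fun i => ev (w i)) = op a g
    simp only [hw]

/-- The points `x` such that `g F` lies in the closure of the intersection of the
neighbourhoods `v x k`, `k ∈ F`, for every finite `F`. -/
def closureFiber {X K : Type u} [TopologicalSpace X] (v : X → K → Set X)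
    (g : Finset K → X) : Set X :=
  {x | ∀ F, g F ∈ closure (⋂ k ∈ F, v x k)}

theorem mk_closureFiber_lt {X K : Type u} [TopologicalSpace X] {n : ℕ} {v : X → K → Set X}
    (hv : ∀ x : Fin n → X, Function.Injective x →
      ∃ k : Fin n → K, (⋂ i, closure (v (x i) (k i))) = ∅)
    (g : Finset K → X) : #(closureFiber v g) < n := by
  classical
  by_contra! h
  have hfin : lift.{u} #(Fin n) ≤ lift.{0} #(closureFiber v g) := by simpa using h
  obtain ⟨f⟩ := lift_mk_le'.1 hfin
  obtain ⟨k, hk⟩ := hv (fun i => f i) (Subtype.val_injective.comp f.injective)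
  have : g (Finset.univ.image k) ∈ ⋂ i, closure (v (f i) (k i)) :=
    mem_iInter.2 fun i => closure_mono
      (biInter_subset_of_mem (Finset.mem_image_of_mem k (Finset.mem_univ i)))
      ((f i).2 (Finset.univ.image k))
  simp [hk] at this

theorem NUPsiLe.exists_indexed {X : Type u} [TopologicalSpace X] {n : ℕ} {κ : Cardinal.{u}}
    (hκ : ℵ₀ ≤ κ) (h : NUPsiLe X n κ) :
    ∃ v : X → κ.out → Set X, (∀ x k, IsOpen (v x k) ∧ x ∈ v x k) ∧
      ∀ x : Fin n → X, Function.Injective x →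
        ∃ k : Fin n → κ.out, (⋂ i, closure (v (x i) (k i))) = ∅ := by
  obtain ⟨V, hV, hsep⟩ := h
  have key : ∀ x, ∃ f : κ.out → Set X, range f = insert Set.univ (V x) := by
    intro x
    have hle : #(insert Set.univ (V x) : Set (Set X)) ≤ #κ.out := by
      rw [mk_out]
      exact mk_insert_le.trans
        ((add_le_add (hV x).1 (one_le_aleph0.trans hκ)).trans (add_eq_self hκ).le)
    obtain ⟨e⟩ := hle
    have : Nonempty (insert Set.univ (V x) : Set (Set X)) := ⟨⟨Set.univ, mem_insert _ _⟩⟩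
    refine ⟨fun k => (Function.invFun e k).1, ?_⟩
    change range (Subtype.val ∘ Function.invFun e) = _
    rw [(Function.invFun_surjective e.injective).range_comp, Subtype.range_coe]
  choose v hv using key
  refine ⟨v, fun x k => ?_, fun x hx => ?_⟩
  · rcases (hv x ▸ mem_range_self k : v x k ∈ insert Set.univ (V x)) with h | h
    · simp [h]
    · exact (hV x).2 _ h
  · obtain ⟨W, hW, hW'⟩ := hsep x hx
    have : ∀ i, ∃ k, v (x i) k = W i := fun i => by
      rw [← mem_range, hv]
      exact mem_insert_of_mem _ (hW i)
    choose k hk using this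
    exact ⟨k, by simpa only [hk] using hW'⟩

/-- an `n`-Urysohn space with the `n`-H-closed covering property
and `n-Uψ(X) ≤ κ` satisfies `|X| ≤ 2^κ`. -/
theorem card_nHClosed_le_two_pow_nUPsi (n : ℕ) (hn : 2 ≤ n)
    (X : Type u) [TopologicalSpace X] (hX : NUrysohn X n)
    (hH : NHClosedCovering X n)
    (κ : Cardinal.{u}) (hκ : ℵ₀ ≤ κ) (hpsi : NUPsiLe X n κ) :
    #X ≤ 2 ^ κ := by
  rcases isEmpty_or_nonempty X with hXe | ⟨⟨x₀⟩⟩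
  · simp
  obtain ⟨v, hvo, hv⟩ := hpsi.exists_indexed hκ
  let E := Finset κ.out
  have : Infinite κ.out := by rwa [infinite_iff, mk_out]
  have hE : #E = κ := by simp [E]
  let N : X → E → Set X := fun x F => ⋂ k ∈ F, v x k
  have hNo : ∀ x F, IsOpen (N x F) := fun x F =>
    isOpen_biInter_finset fun k _ => (hvo x k).1
  have hNx : ∀ x F, x ∈ N x F := fun x F => mem_iInter₂.2 fun k _ => (hvo x k).2
  have henum : ∀ g : E → X, ∃ e : ℕ → X, closureFiber v g ⊆ range e := by
    intro g
    have hc : (closureFiber v g).Countable :=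
      le_aleph0_iff_set_countable.1
        ((mk_closureFiber_lt hv g).le.trans (natCast_le_aleph0))
    have : Nonempty X := ⟨x₀⟩
    exact countable_iff_exists_subset_range.1 hc
  choose enum henum using henum
  have hpick : ∀ (D : E → E) (g : E → X), ∃ q, ∀ p,
      (∀ i, p ∉ closure (N (g i) (D i))) → ∀ i, q ∉ closure (N (g i) (D i)) := by
    intro D g
    by_cases h : ∃ p, ∀ i, p ∉ closure (N (g i) (D i))
    · exact h.imp fun p hp _ _ => hp
    · exact ⟨x₀, fun p hp => absurd ⟨p, hp⟩ h⟩
  choose pick hpick using hpick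
  have hι : #(ULift.{u} ℕ ⊕ (E → E)) ≤ 2 ^ κ := by
    have hc : ℵ₀ ≤ (2 : Cardinal.{u}) ^ κ := hκ.trans (cantor κ).le
    have : #(E → E) = 2 ^ κ := by
      rw [← power_def, hE]
      exact power_self_eq hκ
    rw [mk_sum, lift_id, lift_id, this]
    refine (add_le_add_left ?_ _).trans (add_eq_self hc).le
    simpa using hc
  obtain ⟨H, hx₀, hHc, hop⟩ := exists_mem_mk_le_closed_under_ops hκ hE.le hι x₀
    (Sum.elim (fun m g => enum g m.down) pick)
  suffices H = Set.univ by rwa [this, mk_univ] at hHc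
  by_contra hne
  obtain ⟨p, hp⟩ := (ne_univ_iff_exists_notMem H).1 hne
  have hfar : ∀ y ∉ H, ∃ F, Disjoint (closure (N y F)) H := by
    intro y hy
    by_contra! h
    simp only [not_disjoint_iff] at h
    choose g hg hgH using h
    obtain ⟨m, hm⟩ := henum g (show y ∈ closureFiber v g from hg)
    exact hy (hm ▸ hop (Sum.inl ⟨m⟩) g hgH)
  let A : Set X := H ∩ closureFiber v fun _ => p
  have hA : #A ≤ ((n - 2 : ℕ) : Cardinal) := by
    have hsub : insert p A ⊆ closureFiber v fun _ => p :=
      insert_subset (fun F => subset_closure (hNx p F)) inter_subset_right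
    have hlt := (mk_le_mk_of_subset hsub).trans_lt (mk_closureFiber_lt hv fun _ => p)
    rw [mk_insert fun h => hp h.1] at hlt
    obtain ⟨m, hm⟩ := lt_aleph0.1
      ((self_le_add_right _ 1).trans_lt (hlt.trans natCast_lt_aleph0))
    rw [hm] at hlt ⊢
    norm_cast at hlt ⊢
    lia
  let near : Set (Set X) := {U | ∃ x ∈ H, ∃ F, p ∉ closure U ∧ U = N x F}
  let far : Set (Set X) := {U | IsOpen U ∧ Disjoint (closure U) H}
  obtain ⟨𝒱, h𝒱, hfin, hcov⟩ := hH A hA (near ∪ far)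
    (by
      rintro U (⟨x, -, F, -, rfl⟩ | hU)
      · exact hNo x F
      · exact hU.1)
    (by
      rintro y ⟨-, hyA⟩
      by_cases hy : y ∈ H
      · have : ∃ F, p ∉ closure (N y F) := by
          by_contra! h
          exact hyA ⟨hy, h⟩
        obtain ⟨F, hF⟩ := this
        exact ⟨N y F, Or.inl ⟨y, hy, F, hF, rfl⟩, hNx y F⟩
      · obtain ⟨F, hF⟩ := hfar y hy
        exact ⟨N y F, Or.inr ⟨hNo y F, hF⟩, hNx y F⟩)
  have hnear : ∀ q ∈ H, ∃ U ∈ 𝒱 ∩ near, q ∈ closure U := by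
    intro q hq
    obtain ⟨U, hU, hqU⟩ := mem_iUnion₂.1 (hcov.ge (mem_univ q))
    refine ⟨U, ⟨hU, (h𝒱 hU).resolve_right fun h => ?_⟩, hqU⟩
    exact disjoint_left.1 h.2 hqU hq
  have : Nonempty ↥(𝒱 ∩ near) := by
    obtain ⟨U, hU, -⟩ := hnear x₀ hx₀
    exact ⟨⟨U, hU⟩⟩
  have hle : #↥(𝒱 ∩ near) ≤ lift.{u} #E := by
    rw [hE, lift_id]
    exact (hfin.inter_of_left near).lt_aleph0.le.trans hκ
  rw [lift_id] at hle
  obtain ⟨e⟩ := hle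
  have hs := Function.invFun_surjective e.injective
  choose x hxH F hpF hxF using fun U : ↥(𝒱 ∩ near) => U.2.2
  let s := Function.invFun e
  let D : E → E := F ∘ s
  let g : E → X := x ∘ s
  have hq := hpick D g p fun i => hxF (s i) ▸ hpF (s i)
  obtain ⟨U, hU, hqU⟩ := hnear (pick D g) (hop (Sum.inr D) g fun i => hxH (s i))
  obtain ⟨i, hi⟩ := hs ⟨U, hU⟩
  refine hq i ?_
  change pick D g ∈ closure (N (x (s i)) (F (s i)))
  rw [← hxF (s i), show s i = ⟨U, hU⟩ from hi]
  exact hqU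
end
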